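/- arXiv:2602.22443 — 4 statements merged into one kernel-verified Lean document; each statement's English description precedes it below -/
import Mathlib

section
/- Let n ≥ 3 and N be positive integers, η ∈ (0, 1/4) with η + 1/N ≤ 1 − 2η, γ ∈ (0, 1/(n−1)], and k ≥ 3/(2η). Let p, p' ∈ ℝⁿ be vectors with nonnegative entries summing to 1 and with every entry at least η, such that either p = p' or there exist indices i ≠ j with p_i = p'_i + 1/N, p_j = p'_j − 1/N, and p_l = p'_l for all l ∉ {i, j}, and with p_i, p_j, p'_i, p'_j ∈ [η, 1−2η]. Let μ_{kp} and μ_{kp'} be the Dirichlet measures with parameters kp and kp', and let Ω₁ = { x ∈ ℝ^{n−1} : x_l ≥ γ for all l, and 1 − Σ_{l=1}^{n−1} x_l ≥ γ }. Then for every measurable set A ⊆ Ω₁, μ_{kp}(A) ≤ e^ε · μ_{kp'}(A), where ε = log( B(kη, k(1−2η)) / B(k(η+1/N), k(1−2η−1/N)) ) + (k/N)·log((1−(n−1)γ)/γ). -/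
open MeasureTheory

/-- The Beta function `B(a,b) = Γ(a)Γ(b)/Γ(a+b)`. -/
noncomputable def betaFn (a b : ℝ) : ℝ := Real.Gamma a * Real.Gamma b / Real.Gamma (a + b)

/-- The multivariate Beta function `B(y) = (∏ i, Γ(y i)) / Γ(∑ i, y i)`. -/
noncomputable def multiBeta {n : ℕ} (y : Fin n → ℝ) : ℝ :=
  (∏ i, Real.Gamma (y i)) / Real.Gamma (∑ i, y i)

/-- The Dirichlet measure on `ℝ^m` with parameter vector `α : Fin (m+1) → ℝ`:
the measure with density `B(α)⁻¹ ∏ x_i^{α_i - 1} (1 - ∑ x_i)^{α_{m+1} - 1}` on the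
open simplex and zero elsewhere. -/
noncomputable def dirichletMeasure {m : ℕ} (α : Fin (m+1) → ℝ) :
    Measure (Fin m → ℝ) :=
  volume.withDensity fun x =>
    ENNReal.ofReal <|
      if (∀ i, 0 < x i) ∧ ∑ i, x i < 1 then
        (multiBeta α)⁻¹ * (∏ i : Fin m, x i ^ (α i.castSucc - 1)) *
          (1 - ∑ i, x i) ^ (α (Fin.last m) - 1)
      else 0

/-- Increments of `log Γ` are monotone, by the Bohr-Mollerup log-convexity of `Γ`. -/
lemma Gamma_add_mul_Gamma_le {a b h : ℝ} (ha : 0 < a) (hab : a ≤ b) (hh : 0 < h) :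
    Real.Gamma (a + h) * Real.Gamma b ≤ Real.Gamma a * Real.Gamma (b + h) := by
  have hb : 0 < b := ha.trans_le hab
  have hd : 0 < b + h - a := by linarith
  have hGa := Real.Gamma_pos_of_pos ha
  have hGb := Real.Gamma_pos_of_pos hb
  have hGah := Real.Gamma_pos_of_pos (add_pos ha hh)
  have hGbh := Real.Gamma_pos_of_pos (add_pos hb hh)
  have hconv := Real.convexOn_log_Gamma.2
  have h₁ := @hconv a ha (b + h) (add_pos hb hh) ((b - a) / (b + h - a)) (h / (b + h - a))
    (div_nonneg (by linarith) hd.le) (div_nonneg hh.le hd.le) (by field_simp; ring)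
  have h₂ := @hconv a ha (b + h) (add_pos hb hh) (h / (b + h - a)) ((b - a) / (b + h - a))
    (div_nonneg hh.le hd.le) (div_nonneg (by linarith) hd.le) (by field_simp; ring)
  have e₁ : ((b - a) / (b + h - a)) * a + (h / (b + h - a)) * (b + h) = a + h := by
    field_simp; ring
  have e₂ : (h / (b + h - a)) * a + ((b - a) / (b + h - a)) * (b + h) = b := by
    field_simp; ring
  have e₃ : (b - a) / (b + h - a) = 1 - h / (b + h - a) := by
    field_simp; ring
  simp only [smul_eq_mul, Function.comp_apply, e₁] at h₁
  simp only [smul_eq_mul, Function.comp_apply, e₂] at h₂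
  rw [e₃] at h₁ h₂
  rw [← Real.log_le_log_iff (by positivity) (by positivity),
    Real.log_mul hGah.ne' hGb.ne', Real.log_mul hGa.ne' hGbh.ne']
  linarith

lemma Gamma_div_Gamma_add_le {a b h : ℝ} (ha : 0 < a) (hab : a ≤ b) (hh : 0 < h) :
    Real.Gamma b / Real.Gamma (b + h) ≤ Real.Gamma a / Real.Gamma (a + h) := by
  rw [div_le_div_iff₀ (Real.Gamma_pos_of_pos (by linarith)) (Real.Gamma_pos_of_pos (by linarith)),
    mul_comm (Real.Gamma b)]
  exact Gamma_add_mul_Gamma_le ha hab hh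

lemma Gamma_add_div_Gamma_le {a b h : ℝ} (ha : 0 < a) (hab : a ≤ b) (hh : 0 < h) :
    Real.Gamma (a + h) / Real.Gamma a ≤ Real.Gamma (b + h) / Real.Gamma b := by
  rw [div_le_div_iff₀ (Real.Gamma_pos_of_pos ha) (Real.Gamma_pos_of_pos (by linarith)),
    mul_comm (Real.Gamma (b + h))]
  exact Gamma_add_mul_Gamma_le ha hab hh

lemma betaFn_pos {a b : ℝ} (ha : 0 < a) (hb : 0 < b) : 0 < betaFn a b :=
  div_pos (mul_pos (Real.Gamma_pos_of_pos ha) (Real.Gamma_pos_of_pos hb))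
    (Real.Gamma_pos_of_pos (add_pos ha hb))

lemma betaFn_add_div_betaFn_add {a b h : ℝ} (ha : 0 < a) (hb : 0 < b) (hh : 0 < h) :
    betaFn a (b + h) / betaFn (a + h) b =
      Real.Gamma a / Real.Gamma (a + h) * (Real.Gamma (b + h) / Real.Gamma b) := by
  have h₁ := (Real.Gamma_pos_of_pos hb).ne'
  have h₂ := (Real.Gamma_pos_of_pos (add_pos ha hh)).ne'
  have h₃ := (Real.Gamma_pos_of_pos (add_pos (add_pos ha hh) hb)).ne'
  have e : a + (b + h) = a + h + b := by ring
  simp only [betaFn, e]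
  field_simp

lemma one_le_betaFn_add_div_betaFn_add {a b h : ℝ} (ha : 0 < a) (hab : a ≤ b) (hh : 0 < h) :
    1 ≤ betaFn a (b + h) / betaFn (a + h) b := by
  have hb : 0 < b := ha.trans_le hab
  rw [betaFn_add_div_betaFn_add ha hb hh, div_mul_div_comm,
    one_le_div (mul_pos (Real.Gamma_pos_of_pos (by linarith)) (Real.Gamma_pos_of_pos hb))]
  exact Gamma_add_mul_Gamma_le ha hab hh

lemma multiBeta_pos {n : ℕ} [NeZero n] {y : Fin n → ℝ} (hy : ∀ l, 0 < y l) : 0 < multiBeta y :=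
  div_pos (Finset.prod_pos fun l _ => Real.Gamma_pos_of_pos (hy l))
    (Real.Gamma_pos_of_pos (Finset.sum_pos (fun l _ => hy l) Finset.univ_nonempty))

/-- Moving mass `h` from coordinate `j` to coordinate `i` changes the multivariate Beta function
by at most a ratio of Beta functions at the extreme admissible coordinates `a` and `b`. -/
lemma multiBeta_div_multiBeta_le {n : ℕ} {y y' : Fin n → ℝ} {a b h : ℝ} {i j : Fin n}
    (hy : ∀ l, 0 < y l) (hij : i ≠ j) (hi : y i = y' i + h) (hj : y' j = y j + h)
    (hl : ∀ l, l ≠ i → l ≠ j → y l = y' l) (hs : ∑ l, y l = ∑ l, y' l)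
    (ha : 0 < a) (hh : 0 < h) (hai : a ≤ y' i) (hbj : y j ≤ b) :
    multiBeta y' / multiBeta y ≤ betaFn a (b + h) / betaFn (a + h) b := by
  have : NeZero n := ⟨fun hn => by subst hn; exact i.elim0⟩
  have hS := (Real.Gamma_pos_of_pos
    (Finset.sum_pos (fun l _ => hy l) Finset.univ_nonempty)).ne'
  have hb : 0 < b := (hy j).trans_le hbj
  have hprod : multiBeta y' / multiBeta y =
      ∏ l, Real.Gamma (y' l) / Real.Gamma (y l) := by
    rw [multiBeta, multiBeta, ← hs, div_div_div_cancel_right₀ hS, Finset.prod_div_distrib]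
  rw [hprod, Fintype.prod_eq_mul i j hij, hi, hj, betaFn_add_div_betaFn_add ha hb hh]
  · exact mul_le_mul (Gamma_div_Gamma_add_le ha hai hh) (Gamma_add_div_Gamma_le (hy j) hbj hh)
      (div_nonneg (Real.Gamma_pos_of_pos (by linarith [hy j])).le
        (Real.Gamma_pos_of_pos (hy j)).le)
      (div_nonneg (Real.Gamma_pos_of_pos ha).le (Real.Gamma_pos_of_pos (by linarith)).le)
  · rintro l ⟨hli, hlj⟩
    rw [hl l hli hlj, div_self (hl l hli hlj ▸ (Real.Gamma_pos_of_pos (hy l)).ne')]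

/-- Moving mass `h` from exponent `j` to exponent `i` multiplies a monomial by `(q i / q j) ^ h`. -/
lemma prod_rpow_eq_mul_div_rpow {n : ℕ} {y y' q : Fin n → ℝ} {h : ℝ} {i j : Fin n}
    (hq : ∀ l, 0 < q l) (hij : i ≠ j) (hi : y i = y' i + h) (hj : y' j = y j + h)
    (hl : ∀ l, l ≠ i → l ≠ j → y l = y' l) :
    ∏ l, q l ^ (y l - 1) = (q i / q j) ^ h * ∏ l, q l ^ (y' l - 1) := by
  have hne : ∏ l, q l ^ (y' l - 1) ≠ 0 :=
    (Finset.prod_pos fun l _ => Real.rpow_pos_of_pos (hq l) _).ne'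
  rw [← div_eq_iff hne, ← Finset.prod_div_distrib, Fintype.prod_eq_mul i j hij,
    ← Real.rpow_sub (hq i), ← Real.rpow_sub (hq j), Real.div_rpow (hq i).le (hq j).le,
    div_eq_mul_inv, ← Real.rpow_neg (hq j).le]
  · congr 2 <;> linarith
  · rintro l ⟨hli, hlj⟩
    rw [hl l hli hlj, div_self (Real.rpow_pos_of_pos (hq l) _).ne']

/-- A coordinate of a point of the simplex all of whose coordinates are at least `γ` is at most
one minus `γ` times the number of other coordinates. -/
lemma le_one_sub_mul_of_sum_eq_one {m : ℕ} {q : Fin (m + 1) → ℝ} {γ : ℝ}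
    (hq : ∀ l, γ ≤ q l) (hs : ∑ l, q l = 1) (i : Fin (m + 1)) : q i ≤ 1 - m * γ := by
  rw [Fin.sum_univ_succAbove _ i] at hs
  have h : ∑ _l : Fin m, γ ≤ ∑ l, q (i.succAbove l) := Finset.sum_le_sum fun l _ => hq _
  simp only [Finset.sum_const, Finset.card_univ, Fintype.card_fin, nsmul_eq_mul] at h
  linarith

/-- A pointwise bound between unnormalised densities in homogeneous coordinates bounds the
Dirichlet measures on subsets of the open simplex. -/
lemma dirichletMeasure_le_of_density_le {m : ℕ} {α β : Fin (m + 1) → ℝ} {C : ℝ} (hC : 0 ≤ C)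
    {A : Set (Fin m → ℝ)} (hA : MeasurableSet A)
    (hsub : ∀ x ∈ A, (∀ l, 0 < x l) ∧ ∑ l, x l < 1)
    (h : ∀ x ∈ A, ∀ q : Fin (m + 1) → ℝ, q = Fin.snoc x (1 - ∑ l, x l) →
      (multiBeta α)⁻¹ * ∏ l, q l ^ (α l - 1) ≤ C * ((multiBeta β)⁻¹ * ∏ l, q l ^ (β l - 1))) :
    dirichletMeasure α A ≤ ENNReal.ofReal C * dirichletMeasure β A := by
  rw [dirichletMeasure, dirichletMeasure, withDensity_apply _ hA, withDensity_apply _ hA,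
    ← lintegral_const_mul' _ _ ENNReal.ofReal_ne_top]
  refine setLIntegral_mono' hA fun x hx => ?_
  rw [← ENNReal.ofReal_mul hC, if_pos (hsub x hx), if_pos (hsub x hx)]
  refine ENNReal.ofReal_le_ofReal ?_
  have hx' := h x hx _ rfl
  simp only [Fin.prod_univ_castSucc, Fin.snoc_castSucc, Fin.snoc_last] at hx'
  simpa only [mul_assoc] using hx'

theorem stmt_2 (m : ℕ) (hn : 3 ≤ m + 1) (N : ℕ) (hN : 0 < N)
    (η γ k : ℝ)
    (hη : η ∈ Set.Ioo (0:ℝ) (1/4))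
    (hηN : η + 1/(N:ℝ) ≤ 1 - 2*η)
    (hγ : γ ∈ Set.Ioc (0:ℝ) (1/(m:ℝ)))
    (hk : 3/(2*η) ≤ k)
    (p p' : Fin (m+1) → ℝ)
    (hp0 : ∀ l, 0 ≤ p l) (hp0' : ∀ l, 0 ≤ p' l)
    (hps : ∑ l, p l = 1) (hps' : ∑ l, p' l = 1)
    (hpη : ∀ l, η ≤ p l) (hpη' : ∀ l, η ≤ p' l)
    (hadj : p = p' ∨ ∃ i j : Fin (m+1), i ≠ j ∧
        p i = p' i + 1/(N:ℝ) ∧ p j = p' j - 1/(N:ℝ) ∧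
        (∀ l, l ≠ i → l ≠ j → p l = p' l) ∧
        p i ∈ Set.Icc η (1-2*η) ∧ p j ∈ Set.Icc η (1-2*η) ∧
        p' i ∈ Set.Icc η (1-2*η) ∧ p' j ∈ Set.Icc η (1-2*η)) :
    ∀ A : Set (Fin m → ℝ), MeasurableSet A →
      A ⊆ {x | (∀ l, γ ≤ x l) ∧ γ ≤ 1 - ∑ l, x l} →
      dirichletMeasure (fun l => k * p l) A ≤
        ENNReal.ofReal (Real.exp (
          Real.log (betaFn (k*η) (k*(1-2*η)) /
              betaFn (k*(η+1/(N:ℝ))) (k*(1-2*η-1/(N:ℝ)))) +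
            (k/(N:ℝ)) * Real.log ((1-(m:ℝ)*γ)/γ))) *
          dirichletMeasure (fun l => k * p' l) A := by
  obtain ⟨hη0, -⟩ := hη
  obtain ⟨hγ0, -⟩ := hγ
  have hk0 : 0 < k := lt_of_lt_of_le (by positivity) hk
  have hd : 0 < 1 / (N : ℝ) := by positivity
  have hkd : 0 < k * (1 / (N : ℝ)) := mul_pos hk0 hd
  have ha : 0 < k * η := mul_pos hk0 hη0
  have hab : k * η ≤ k * (1 - 2 * η - 1 / (N : ℝ)) :=
    mul_le_mul_of_nonneg_left (by linarith) hk0.le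
  have hb : 0 < k * (1 - 2 * η - 1 / (N : ℝ)) := ha.trans_le hab
  have e₁ : k * (η + 1 / (N : ℝ)) = k * η + k * (1 / (N : ℝ)) := by ring
  have e₂ : k * (1 - 2 * η) = k * (1 - 2 * η - 1 / (N : ℝ)) + k * (1 / (N : ℝ)) := by ring
  have e₃ : k / (N : ℝ) = k * (1 / (N : ℝ)) := by ring
  rw [e₁, e₂, e₃]
  intro A hA hAsub
  have hα : ∀ l, 0 < k * p l := fun l => mul_pos hk0 (hη0.trans_le (hpη l))
  have hα' : ∀ l, 0 < k * p' l := fun l => mul_pos hk0 (hη0.trans_le (hpη' l))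
  refine dirichletMeasure_le_of_density_le (Real.exp_pos _).le hA
    (fun x hx => ⟨fun l => hγ0.trans_le ((hAsub hx).1 l), by linarith [(hAsub hx).2]⟩) ?_
  rintro x hx q hq
  have hqγ : ∀ l, γ ≤ q l := by
    intro l
    rw [hq]
    induction l using Fin.lastCases with
    | last => simpa using (hAsub hx).2
    | cast l => simpa using (hAsub hx).1 l
  have hq0 : ∀ l, 0 < q l := fun l => hγ0.trans_le (hqγ l)
  have hqs : ∑ l, q l = 1 := by simp [hq, Fin.sum_univ_castSucc]
  have hqle := le_one_sub_mul_of_sum_eq_one hqγ hqs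
  have hr : 1 ≤ (1 - m * γ) / γ := (one_le_div hγ0).2 ((hqγ 0).trans (hqle 0))
  have hr0 : 0 < (1 - m * γ) / γ := one_pos.trans_le hr
  rw [Real.exp_add, Real.exp_log (div_pos (betaFn_pos ha (add_pos hb hkd))
    (betaFn_pos (add_pos ha hkd) hb)), mul_comm (k * (1 / (N : ℝ))) (Real.log _),
    ← Real.rpow_def_of_pos hr0]
  have hprod : 0 < ∏ l, q l ^ (k * p' l - 1) :=
    Finset.prod_pos fun l _ => Real.rpow_pos_of_pos (hq0 l) _
  have hB := multiBeta_pos hα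
  have hB' := multiBeta_pos hα'
  rcases hadj with rfl | ⟨i, j, hij, hi, hj, hl, -, -, -, hj'⟩
  · refine le_mul_of_one_le_left (mul_pos (inv_pos.2 hB) hprod).le ?_
    exact one_le_mul_of_one_le_of_one_le (one_le_betaFn_add_div_betaFn_add ha hab hkd)
      (Real.one_le_rpow hr hkd.le)
  · have hi' : k * p i = k * p' i + k * (1 / (N : ℝ)) := by rw [hi]; ring
    have hj'' : k * p' j = k * p j + k * (1 / (N : ℝ)) := by rw [hj]; ring
    have hl' : ∀ l, l ≠ i → l ≠ j → k * p l = k * p' l := fun l h₁ h₂ => by rw [hl l h₁ h₂]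
    have hbeta := multiBeta_div_multiBeta_le (y := fun l => k * p l) (y' := fun l => k * p' l)
      hα hij hi' hj'' hl' (by rw [← Finset.mul_sum, ← Finset.mul_sum, hps, hps']) ha hkd
      (mul_le_mul_of_nonneg_left (hpη' i) hk0.le)
      (mul_le_mul_of_nonneg_left (show p j ≤ 1 - 2 * η - 1 / (N : ℝ) by linarith [hj'.2]) hk0.le)
    have hpow : (q i / q j) ^ (k * (1 / (N : ℝ))) ≤
        ((1 - m * γ) / γ) ^ (k * (1 / (N : ℝ))) :=
      Real.rpow_le_rpow (div_pos (hq0 i) (hq0 j)).le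
        (div_le_div₀ ((hq0 i).le.trans (hqle i)) (hqle i) hγ0 (hqγ j)) hkd.le
    rw [prod_rpow_eq_mul_div_rpow (y := fun l => k * p l) (y' := fun l => k * p' l)
      hq0 hij hi' hj'' hl']
    calc _ = (multiBeta (fun l => k * p' l) / multiBeta (fun l => k * p l) *
            (q i / q j) ^ (k * (1 / (N : ℝ)))) *
          ((multiBeta fun l => k * p' l)⁻¹ * ∏ l, q l ^ (k * p' l - 1)) := by
          field_simp
      _ ≤ _ := by
          refine mul_le_mul_of_nonneg_right ?_ (mul_pos (inv_pos.2 hB') hprod).le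
          exact mul_le_mul hbeta hpow (Real.rpow_nonneg (div_pos (hq0 i) (hq0 j)).le _)
            ((div_pos hB' hB).le.trans hbeta)
end

section
/- Let m be a positive integer and for each i ∈ {1, …, m} let P_i and Q_i be probability measures on a measurable space S_i, with parameters ε_i ≥ 0 and δ_i ∈ [0, 1] such that P_i(T) ≤ e^{ε_i} Q_i(T) + δ_i for every measurable T ⊆ S_i. Suppose moreover that there is an index j such that P_i = Q_i for every i ≠ j. Then the product measures satisfy (P_1 ⊗ ⋯ ⊗ P_m)(S) ≤ e^{max_i ε_i} (Q_1 ⊗ ⋯ ⊗ Q_m)(S) + max_i δ_i for every measurable set S ⊆ S_1 × ⋯ × S_m. -/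
open MeasureTheory

/-- An approximate domination `μ T ≤ c * ν T + d` is preserved by taking the product with a common
probability measure. -/
theorem prod_le_mul_prod_add {α β : Type*} [MeasurableSpace α] [MeasurableSpace β]
    {μ ν : Measure α} [SFinite μ] [SFinite ν] (ρ : Measure β) [IsProbabilityMeasure ρ]
    {c d : ENNReal} (h : ∀ T, MeasurableSet T → μ T ≤ c * ν T + d)
    {B : Set (α × β)} (hB : MeasurableSet B) :
    μ.prod ρ B ≤ c * ν.prod ρ B + d := by
  rw [Measure.prod_apply_symm hB, Measure.prod_apply_symm hB]
  calc ∫⁻ y, μ ((fun x => (x, y)) ⁻¹' B) ∂ρ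
      ≤ ∫⁻ y, (c * ν ((fun x => (x, y)) ⁻¹' B) + d) ∂ρ :=
        lintegral_mono fun y => h _ (measurable_prodMk_right hB)
    _ = c * ∫⁻ y, ν ((fun x => (x, y)) ⁻¹' B) ∂ρ + d := by
        rw [lintegral_add_right _ measurable_const,
          lintegral_const_mul _ (measurable_measure_prodMk_right hB), lintegral_const,
          measure_univ, mul_one]

theorem stmt_4 (m : ℕ) {S : Fin (m+1) → Type*} [∀ i, MeasurableSpace (S i)]
    (P Q : ∀ i, Measure (S i))
    [∀ i, IsProbabilityMeasure (P i)] [∀ i, IsProbabilityMeasure (Q i)]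
    (ε δ : Fin (m+1) → ℝ)
    (hε : ∀ i, 0 ≤ ε i) (hδ : ∀ i, δ i ∈ Set.Icc (0:ℝ) 1)
    (hdp : ∀ i, ∀ T : Set (S i), MeasurableSet T →
      P i T ≤ ENNReal.ofReal (Real.exp (ε i)) * Q i T + ENNReal.ofReal (δ i))
    (j : Fin (m+1)) (hj : ∀ i, i ≠ j → P i = Q i) :
    ∀ A : Set (∀ i, S i), MeasurableSet A →
      Measure.pi P A ≤
        ENNReal.ofReal (Real.exp (Finset.univ.sup' Finset.univ_nonempty ε)) *
          Measure.pi Q A +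
          ENNReal.ofReal (Finset.univ.sup' Finset.univ_nonempty δ) := by
  intro A hA
  have hrest : (fun i => P (j.succAbove i)) = fun i => Q (j.succAbove i) :=
    funext fun i => hj _ (j.succAbove_ne i)
  have hP := (measurePreserving_piFinSuccAbove P j).symm.measure_preimage_equiv A
  have hQ := (measurePreserving_piFinSuccAbove Q j).symm.measure_preimage_equiv A
  rw [← hP, ← hQ, hrest]
  have hε_le : ε j ≤ Finset.univ.sup' Finset.univ_nonempty ε :=
    Finset.le_sup' ε (Finset.mem_univ j)
  have hδ_le : δ j ≤ Finset.univ.sup' Finset.univ_nonempty δ :=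
    Finset.le_sup' δ (Finset.mem_univ j)
  refine (prod_le_mul_prod_add _ (hdp j) (MeasurableEquiv.measurable _ hA)).trans ?_
  gcongr
end

section
/- Let n ≥ 2 be an integer, k > 0, and let C ∈ ℝⁿ have strictly positive entries summing to 1. Let E = { x ∈ ℝ^{n−1} : x_i > 0 for all i, Σ_{i=1}^{n−1} x_i < 1 }, and for x ∈ E write x_n = 1 − Σ_{i=1}^{n−1} x_i. Then ∫_E ( Σ_{i=1}^{n} C_i log(C_i / x_i) ) · B(kC)^{-1} ∏_{i=1}^{n−1} x_i^{k C_i − 1} x_n^{k C_n − 1} dx = Σ_{i=1}^{n} C_i ( log C_i + ψ(k) − ψ(k C_i) ). -/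
open MeasureTheory

/-- The digamma function `ψ(x) = (log Γ)'(x)`. -/
noncomputable def digamma (x : ℝ) : ℝ := deriv (fun y => Real.log (Real.Gamma y)) x

open ProbabilityTheory

open scoped ENNReal

/-- The Riemann-Liouville kernel `x ^ (a - 1) / Γ(a)` on the positive half-line, zero elsewhere. -/
noncomputable def rlKernel (a x : ℝ) : ℝ≥0∞ :=
  if 0 < x then ENNReal.ofReal (x ^ (a - 1) / Real.Gamma a) else 0

@[fun_prop]
lemma measurable_rlKernel (a : ℝ) : Measurable (rlKernel a) :=
  Measurable.ite measurableSet_Ioi (by fun_prop) (by fun_prop)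

lemma rlKernel_of_pos {a x : ℝ} (hx : 0 < x) :
    rlKernel a x = ENNReal.ofReal (x ^ (a - 1) / Real.Gamma a) := if_pos hx

lemma rlKernel_of_nonpos {a x : ℝ} (hx : x ≤ 0) : rlKernel a x = 0 := if_neg hx.not_gt

lemma rlKernel_ne_top (a x : ℝ) : rlKernel a x ≠ ∞ := by
  unfold rlKernel; split_ifs <;> simp

lemma rlKernel_mul_left (a x : ℝ) {s : ℝ} (hs : 0 < s) :
    rlKernel a (s * x) = ENNReal.ofReal (s ^ (a - 1)) * rlKernel a x := by
  rcases lt_or_ge 0 x with hx | hx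
  · rw [rlKernel_of_pos hx, rlKernel_of_pos (mul_pos hs hx), ← ENNReal.ofReal_mul (by positivity),
      Real.mul_rpow hs.le hx.le, mul_div_assoc]
  · rw [rlKernel_of_nonpos hx, rlKernel_of_nonpos (mul_nonpos_of_nonneg_of_nonpos hs.le hx),
      mul_zero]

lemma lintegral_rlKernel_mul_one_sub {a b : ℝ} (ha : 0 < a) (hb : 0 < b) :
    ∫⁻ x, rlKernel a x * rlKernel b (1 - x) = ENNReal.ofReal (1 / Real.Gamma (a + b)) := by
  have h : ∀ x, rlKernel a x * rlKernel b (1 - x)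
      = ENNReal.ofReal (1 / Real.Gamma (a + b)) * betaPDF a b x := by
    intro x
    rcases le_or_gt x 0 with hx | hx
    · rw [rlKernel_of_nonpos hx, betaPDF_eq_zero_of_nonpos hx, zero_mul, mul_zero]
    rcases le_or_gt 1 x with hx1 | hx1
    · rw [rlKernel_of_nonpos (sub_nonpos.2 hx1), betaPDF_eq_zero_of_one_le hx1, mul_zero, mul_zero]
    have hx2 : 0 < 1 - x := sub_pos.2 hx1
    have h1 := Real.Gamma_pos_of_pos ha
    have h2 := Real.Gamma_pos_of_pos hb
    have h3 := Real.Gamma_pos_of_pos (add_pos ha hb)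
    rw [rlKernel_of_pos hx, rlKernel_of_pos hx2, betaPDF_of_pos_lt_one hx hx1,
      ← ENNReal.ofReal_mul (by positivity), ← ENNReal.ofReal_mul (by positivity), beta]
    congr 1
    field_simp
  simp_rw [h]
  rw [lintegral_const_mul' _ _ ENNReal.ofReal_ne_top, lintegral_betaPDF_eq_one ha hb, mul_one]

/-- The semigroup property of the Riemann-Liouville kernels. -/
lemma lintegral_rlKernel_mul_sub {a b : ℝ} (ha : 0 < a) (hb : 0 < b) (s : ℝ) :
    ∫⁻ x, rlKernel a x * rlKernel b (s - x) = rlKernel (a + b) s := by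
  rcases le_or_gt s 0 with hs | hs
  · rw [rlKernel_of_nonpos hs, lintegral_eq_zero_of_ae_eq_zero]
    refine .of_forall fun x => ?_
    rcases le_or_gt x 0 with hx | hx
    · simp [rlKernel_of_nonpos hx]
    · simp [rlKernel_of_nonpos (show s - x ≤ 0 by linarith)]
  · have h3 := Real.Gamma_pos_of_pos (add_pos ha hb)
    have hm : Measurable fun x => rlKernel a x * rlKernel b (s - x) := by fun_prop
    have hsc : ∀ x, rlKernel a (s * x) * rlKernel b (s - s * x) =
        ENNReal.ofReal (s ^ (a - 1) * s ^ (b - 1)) * (rlKernel a x * rlKernel b (1 - x)) := by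
      intro x
      rw [← mul_one_sub, rlKernel_mul_left _ _ hs, rlKernel_mul_left _ _ hs,
        ENNReal.ofReal_mul (by positivity)]
      ring
    have hpow : s * (s ^ (a - 1) * s ^ (b - 1)) = s ^ (a + b - 1) := by
      rw [← Real.rpow_add hs, show a + b - 1 = 1 + (a - 1 + (b - 1)) by ring, Real.rpow_add hs 1,
        Real.rpow_one]
    rw [← Real.smul_map_volume_mul_left hs.ne', lintegral_smul_measure,
      lintegral_map hm (by fun_prop)]
    simp_rw [hsc]
    rw [lintegral_const_mul' _ _ ENNReal.ofReal_ne_top, lintegral_rlKernel_mul_one_sub ha hb,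
      rlKernel_of_pos hs, smul_eq_mul, ← ENNReal.ofReal_mul (by positivity),
      ← ENNReal.ofReal_mul (by positivity), abs_of_pos hs, ← mul_assoc, hpow, mul_one_div]

/-- Dirichlet's integral in normalized form. -/
lemma lintegral_prod_rlKernel {m : ℕ} (a : Fin m → ℝ) (ha : ∀ i, 0 < a i) {b : ℝ} (hb : 0 < b)
    (s : ℝ) :
    ∫⁻ x : Fin m → ℝ, (∏ i, rlKernel (a i) (x i)) * rlKernel b (s - ∑ i, x i)
      = rlKernel (∑ i, a i + b) s := by
  induction m generalizing s with
  | zero => simp [volume_pi]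
  | succ m ih =>
    have hmeas : Measurable fun x : Fin (m + 1) → ℝ =>
      (∏ i, rlKernel (a i) (x i)) * rlKernel b (s - ∑ i, x i) := by fun_prop
    have he := (volume_preserving_piFinSuccAbove (fun _ : Fin (m + 1) => ℝ) 0).symm
    rw [← he.lintegral_comp hmeas, Measure.volume_eq_prod, lintegral_prod _ (by fun_prop)]
    simp only [MeasurableEquiv.piFinSuccAbove_symm_apply, Fin.insertNthEquiv_apply,
      Fin.insertNth_zero', Fin.prod_univ_succ, Fin.sum_univ_succ, Fin.cons_zero, Fin.cons_succ,
      mul_assoc, ← sub_sub]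
    have hin : ∀ x : ℝ, ∫⁻ y : Fin m → ℝ, rlKernel (a 0) x *
        ((∏ i : Fin m, rlKernel (a i.succ) (y i)) * rlKernel b (s - x - ∑ i, y i))
        = rlKernel (a 0) x * rlKernel (∑ i : Fin m, a i.succ + b) (s - x) := by
      intro x
      rw [lintegral_const_mul' _ _ (rlKernel_ne_top _ _), ih _ fun i => ha _]
    have hpos : 0 < ∑ i : Fin m, a i.succ + b :=
      add_pos_of_nonneg_of_pos (Finset.sum_nonneg fun i _ => (ha _).le) hb
    erw [lintegral_congr hin]
    rw [lintegral_rlKernel_mul_sub (ha 0) hpos, add_assoc]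

/-- The full barycentric coordinates of a point of the solid simplex. -/
noncomputable def barycentric {m : ℕ} (x : Fin m → ℝ) : Fin (m + 1) → ℝ :=
  Fin.snoc x (1 - ∑ l, x l)

/-- The unnormalized Dirichlet density. -/
noncomputable def dirichletKernel {m : ℕ} (a : Fin (m + 1) → ℝ) (x : Fin m → ℝ) : ℝ≥0∞ :=
  ∏ i, rlKernel (a i) (barycentric x i)

lemma dirichletKernel_eq {m : ℕ} (a : Fin (m + 1) → ℝ) (x : Fin m → ℝ) :
    dirichletKernel a x = (∏ i : Fin m, rlKernel (a i.castSucc) (x i)) *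
      rlKernel (a (Fin.last m)) (1 - ∑ i, x i) := by
  simp [dirichletKernel, barycentric, Fin.prod_univ_castSucc]

@[fun_prop]
lemma measurable_dirichletKernel {m : ℕ} (a : Fin (m + 1) → ℝ) :
    Measurable (dirichletKernel a) := by
  simp_rw [funext (dirichletKernel_eq a)]
  fun_prop

lemma dirichletKernel_ne_top {m : ℕ} (a : Fin (m + 1) → ℝ) (x : Fin m → ℝ) :
    dirichletKernel a x ≠ ∞ :=
  ENNReal.prod_ne_top fun _ _ => rlKernel_ne_top _ _

lemma lintegral_dirichletKernel {m : ℕ} (a : Fin (m + 1) → ℝ) (ha : ∀ i, 0 < a i) :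
    ∫⁻ x, dirichletKernel a x = ENNReal.ofReal (1 / Real.Gamma (∑ i, a i)) := by
  simp_rw [dirichletKernel_eq]
  rw [lintegral_prod_rlKernel _ (fun i => ha _) (ha _), ← Fin.sum_univ_castSucc,
    rlKernel_of_pos one_pos, Real.one_rpow]

lemma barycentric_pos_iff {m : ℕ} (x : Fin m → ℝ) :
    (∀ i, 0 < barycentric x i) ↔ (∀ i, 0 < x i) ∧ ∑ i, x i < 1 := by
  simp [barycentric, Fin.forall_fin_succ']

lemma dirichletKernel_of_not_pos {m : ℕ} (a : Fin (m + 1) → ℝ) {x : Fin m → ℝ}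
    (hx : ¬ ∀ i, 0 < barycentric x i) : dirichletKernel a x = 0 := by
  push Not at hx
  obtain ⟨i, hi⟩ := hx
  exact Finset.prod_eq_zero (Finset.mem_univ i) (rlKernel_of_nonpos hi)

lemma rlKernel_mul_exp {a c x : ℝ} (ha : 0 < a) (hac : 0 < a + c) (hx : 0 < x) :
    rlKernel a x * ENNReal.ofReal (Real.exp (c * Real.log x))
      = ENNReal.ofReal (Real.Gamma (a + c) / Real.Gamma a) * rlKernel (a + c) x := by
  have h1 := Real.Gamma_pos_of_pos ha
  have h2 := Real.Gamma_pos_of_pos hac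
  rw [rlKernel_of_pos hx, rlKernel_of_pos hx, ← ENNReal.ofReal_mul (by positivity),
    ← ENNReal.ofReal_mul (by positivity), mul_comm c, ← Real.rpow_def_of_pos hx,
    show a + c - 1 = (a - 1) + c by ring, Real.rpow_add hx]
  congr 1
  field_simp

lemma dirichletKernel_mul_exp {m : ℕ} {a c : Fin (m + 1) → ℝ} (ha : ∀ i, 0 < a i)
    (hac : ∀ i, 0 < a i + c i) (x : Fin m → ℝ) :
    dirichletKernel a x * ENNReal.ofReal (Real.exp (∑ i, c i * Real.log (barycentric x i)))
      = ENNReal.ofReal (∏ i, Real.Gamma (a i + c i) / Real.Gamma (a i)) *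
        dirichletKernel (fun i => a i + c i) x := by
  by_cases hx : ∀ i, 0 < barycentric x i
  · rw [Real.exp_sum, ENNReal.ofReal_prod_of_nonneg (fun i _ => (Real.exp_pos _).le),
      ENNReal.ofReal_prod_of_nonneg, dirichletKernel, dirichletKernel, ← Finset.prod_mul_distrib,
      ← Finset.prod_mul_distrib]
    · exact Finset.prod_congr rfl fun i _ => rlKernel_mul_exp (ha i) (hac i) (hx i)
    · exact fun i _ =>
        (div_pos (Real.Gamma_pos_of_pos (hac i)) (Real.Gamma_pos_of_pos (ha i))).le
  · rw [dirichletKernel_of_not_pos _ hx, dirichletKernel_of_not_pos _ hx, zero_mul, mul_zero]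

@[fun_prop]
lemma measurable_barycentric {m : ℕ} (i : Fin (m + 1)) :
    Measurable fun x : Fin m → ℝ => barycentric x i := by
  refine Fin.lastCases ?_ (fun i => ?_) i
  · simp only [barycentric, Fin.snoc_last]; fun_prop
  · simp only [barycentric, Fin.snoc_castSucc]; fun_prop

lemma lintegral_exp_withDensity_dirichletKernel {m : ℕ} {a c : Fin (m + 1) → ℝ}
    (ha : ∀ i, 0 < a i) (hac : ∀ i, 0 < a i + c i) :
    ∫⁻ x, ENNReal.ofReal (Real.exp (∑ i, c i * Real.log (barycentric x i)))
        ∂(volume.withDensity (dirichletKernel a))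
      = ENNReal.ofReal ((∏ i, Real.Gamma (a i + c i) / Real.Gamma (a i)) *
        (1 / Real.Gamma (∑ i, (a i + c i)))) := by
  rw [lintegral_withDensity_eq_lintegral_mul _ (by fun_prop) (by fun_prop)]
  simp only [Pi.mul_apply, dirichletKernel_mul_exp ha hac]
  rw [lintegral_const_mul' _ _ ENNReal.ofReal_ne_top, lintegral_dirichletKernel _ hac,
    ← ENNReal.ofReal_mul]
  exact Finset.prod_nonneg fun i _ =>
        (div_pos (Real.Gamma_pos_of_pos (hac i)) (Real.Gamma_pos_of_pos (ha i))).le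

lemma hasDerivAt_Gamma_digamma {x : ℝ} (hx : 0 < x) :
    HasDerivAt Real.Gamma (Real.Gamma x * digamma x) x := by
  have hd : DifferentiableAt ℝ Real.Gamma x :=
    Real.differentiableAt_Gamma fun m => by have : (0 : ℝ) ≤ m := m.cast_nonneg; linarith
  have h0 := (Real.Gamma_pos_of_pos hx).ne'
  rw [digamma, (hd.hasDerivAt.log h0).deriv, mul_div_cancel₀ _ h0]
  exact hd.hasDerivAt

theorem stmt_5 (m : ℕ) (hm : 1 ≤ m) (k : ℝ) (hk : 0 < k)
    (C : Fin (m+1) → ℝ) (hC : ∀ i, 0 < C i) (hsum : ∑ i, C i = 1) :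
    (∫ x in {x : Fin m → ℝ | (∀ i, 0 < x i) ∧ ∑ i, x i < 1},
      (∑ i : Fin (m+1), C i * Real.log (C i / (Fin.snoc x (1 - ∑ l, x l) : Fin (m+1) → ℝ) i)) *
        ((multiBeta fun i => k * C i)⁻¹ *
          (∏ i : Fin m, x i ^ (k * C i.castSucc - 1)) *
          (1 - ∑ i, x i) ^ (k * C (Fin.last m) - 1)))
      = ∑ i, C i * (Real.log (C i) + digamma k - digamma (k * C i)) := by
  set a : Fin (m + 1) → ℝ := fun i => k * C i
  have ha : ∀ i, 0 < a i := fun i => mul_pos hk (hC i)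
  have hasum : ∑ i, a i = k := by rw [← Finset.mul_sum, hsum, mul_one]
  set μ : Measure (Fin m → ℝ) := volume.withDensity (dirichletKernel a) with hμ
  set X : (Fin m → ℝ) → ℝ := fun x => ∑ i, C i * Real.log (barycentric x i) with hX
  have hXm : Measurable X := by fun_prop
  have hΓk := Real.Gamma_pos_of_pos hk
  have hΓ : ∀ i, 0 < Real.Gamma (a i) := fun i => Real.Gamma_pos_of_pos (ha i)
  have hlin : ∀ t, -k < t → ∫⁻ x, ENNReal.ofReal (Real.exp (t * X x)) ∂μ =
      ENNReal.ofReal ((∏ i, Real.Gamma (a i + t * C i) / Real.Gamma (a i)) *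
        (1 / Real.Gamma (k + t))) := by
    intro t ht
    have := lintegral_exp_withDensity_dirichletKernel (c := fun i => t * C i) ha
      (fun i => by have := mul_pos (show 0 < k + t by linarith) (hC i); simp only [a]; linarith)
    rw [Finset.sum_add_distrib, hasum, ← Finset.mul_sum, hsum, mul_one] at this
    rw [← this]
    simp only [X, μ, Finset.mul_sum, mul_assoc]
  have hint : ∀ t, -k < t → Integrable (fun x => Real.exp (t * X x)) μ := by
    intro t ht
    refine ⟨by fun_prop, ?_⟩
    rw [hasFiniteIntegral_iff_ofReal (.of_forall fun x => (Real.exp_pos _).le), hlin t ht]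
    exact ENNReal.ofReal_lt_top
  have hmgf : ∀ t, -k < t → mgf X μ t =
      (∏ i, Real.Gamma (a i + t * C i) / Real.Gamma (a i)) * (1 / Real.Gamma (k + t)) := by
    intro t ht
    rw [mgf, integral_eq_lintegral_of_nonneg_ae (.of_forall fun x => (Real.exp_pos _).le)
      (by fun_prop), hlin t ht, ENNReal.toReal_ofReal]
    refine mul_nonneg (Finset.prod_nonneg fun i _ => div_nonneg (Real.Gamma_pos_of_pos ?_).le
      (hΓ i).le) (one_div_pos.2 (Real.Gamma_pos_of_pos (by linarith))).le
    have := mul_pos (show 0 < k + t by linarith) (hC i)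
    simp only [a]; linarith
  have hnhds : Set.Ioi (-k) ∈ nhds (0 : ℝ) := Ioi_mem_nhds (by linarith)
  have h0 : (0 : ℝ) ∈ interior (integrableExpSet X μ) :=
    mem_interior_iff_mem_nhds.2 (Filter.mem_of_superset hnhds fun t ht => hint t ht)
  have hprod : HasDerivAt (fun t => ∏ i, Real.Gamma (a i + t * C i) / Real.Gamma (a i))
      (∑ i, C i * digamma (a i)) 0 := by
    have h1 : ∀ i ∈ Finset.univ, HasDerivAt
        (fun t => Real.Gamma (a i + t * C i) / Real.Gamma (a i)) (C i * digamma (a i)) 0 := by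
      intro i _
      have h2 : HasDerivAt (fun t => a i + t * C i) (C i) 0 := by
        simpa using ((hasDerivAt_id (0 : ℝ)).mul_const (C i)).const_add (a i)
      have h3 : HasDerivAt Real.Gamma (Real.Gamma (a i) * digamma (a i)) (a i + 0 * C i) := by
        simpa using hasDerivAt_Gamma_digamma (ha i)
      refine ((h3.comp 0 h2).div_const (Real.Gamma (a i))).congr_deriv ?_
      have := (hΓ i).ne'
      field_simp
    refine (HasDerivAt.fun_finsetProd h1).congr_deriv ?_
    refine Finset.sum_congr rfl fun i _ => ?_
    simp [div_self (hΓ _).ne']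
  have hinv : HasDerivAt (fun t => 1 / Real.Gamma (k + t)) (-digamma k / Real.Gamma k) 0 := by
    have h3 : HasDerivAt Real.Gamma (Real.Gamma k * digamma k) (k + 0) := by
      simpa using hasDerivAt_Gamma_digamma hk
    have h4 := (h3.comp_const_add k 0).inv (by simpa using hΓk.ne')
    simp only [one_div]
    refine h4.congr_deriv ?_
    rw [add_zero]
    field_simp
  have hEX : ∫ x, X x ∂μ = (∑ i, C i * digamma (a i) - digamma k) / Real.Gamma k := by
    rw [← deriv_mgf_zero h0]
    refine HasDerivAt.deriv ?_
    refine HasDerivAt.congr_of_eventuallyEq ?_ (Filter.mem_of_superset hnhds fun t ht => hmgf t ht)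
    refine (hprod.mul hinv).congr_deriv ?_
    have hone : ∏ i, Real.Gamma (a i + 0 * C i) / Real.Gamma (a i) = 1 :=
      Finset.prod_eq_one fun i _ => by rw [zero_mul, add_zero, div_self (hΓ i).ne']
    rw [hone, add_zero]
    ring
  have hE1 : ∫ _x, (1 : ℝ) ∂μ = 1 / Real.Gamma k := by
    have := hmgf 0 (by linarith)
    simpa [mgf, div_self (hΓ _).ne'] using this
  have hXint : Integrable X μ := integrable_of_mem_interior_integrableExpSet h0
  have h1int : Integrable (fun _ => (1 : ℝ)) μ := by simpa using hint 0 (by linarith)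
  have hS : MeasurableSet {x : Fin m → ℝ | (∀ i, 0 < x i) ∧ ∑ i, x i < 1} := by
    measurability
  have key : ∫ x, Real.Gamma k * ((∑ i, C i * Real.log (C i)) * 1 - X x) ∂μ =
      ∑ i, C i * (Real.log (C i) + digamma k - digamma (k * C i)) := by
    rw [integral_const_mul, integral_sub (h1int.const_mul _) hXint, integral_const_mul, hE1, hEX]
    have : ∑ i, C i * (Real.log (C i) + digamma k - digamma (k * C i)) =
        ∑ i, C i * Real.log (C i) + digamma k - ∑ i, C i * digamma (a i) := by
      simp only [mul_sub, mul_add, Finset.sum_sub_distrib, Finset.sum_add_distrib,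
        ← Finset.sum_mul, hsum, one_mul, a]
    rw [this]
    field_simp
    ring
  rw [← key, hμ, integral_withDensity_eq_integral_toReal_smul (by fun_prop)
    (.of_forall fun x => (dirichletKernel_ne_top a x).lt_top), ← integral_indicator hS]
  congr 1 with x
  by_cases hx : x ∈ {x : Fin m → ℝ | (∀ i, 0 < x i) ∧ ∑ i, x i < 1}
  · rw [Set.indicator_of_mem hx]
    have hb := (barycentric_pos_iff x).2 hx
    have hlog : ∑ i, C i * Real.log (C i / barycentric x i) =
        (∑ i, C i * Real.log (C i)) * 1 - X x := by
      rw [mul_one, ← Finset.sum_sub_distrib]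
      refine Finset.sum_congr rfl fun i _ => ?_
      rw [Real.log_div (hC i).ne' (hb i).ne', mul_sub]
    have hden : (dirichletKernel a x).toReal = (∏ i, Real.Gamma (a i))⁻¹ *
        ((∏ i : Fin m, x i ^ (k * C i.castSucc - 1)) *
          (1 - ∑ i, x i) ^ (k * C (Fin.last m) - 1)) := by
      have h1 : ∀ i, (rlKernel (a i) (barycentric x i)).toReal =
          (Real.Gamma (a i))⁻¹ * barycentric x i ^ (a i - 1) := by
        intro i
        rw [rlKernel_of_pos (hb i), ENNReal.toReal_ofReal
          (div_nonneg (Real.rpow_nonneg (hb i).le _) (hΓ i).le), div_eq_inv_mul]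
      rw [dirichletKernel, ENNReal.toReal_prod, Finset.prod_congr rfl fun i _ => h1 i,
        Finset.prod_mul_distrib, Finset.prod_inv_distrib]
      congr 1
      simp [Fin.prod_univ_castSucc, barycentric, a]
    change (∑ i, C i * Real.log (C i / barycentric x i)) * _ = _
    rw [hlog, hden, smul_eq_mul, multiBeta, hasum, inv_div]
    ring
  · rw [Set.indicator_of_notMem hx, dirichletKernel_of_not_pos _ (mt (barycentric_pos_iff x).1 hx)]
    simp
end

section
/- Let n and N be integers with 2 ≤ n ≤ N, let k ≥ 3N/2, and let p ∈ ℝⁿ satisfy Σ_{i=1}^n p_i = 1 and p_i ∈ [1/N, (N−n+1)/N] for all i. Then Σ_{i=1}^{n} p_i ( log p_i + ψ(k) − ψ(k p_i) ) ≤ ((n−1)/N)·( log(1/N) − ψ(k/N) ) + ((N−n+1)/N)·( log((N−n+1)/N) − ψ(k(N−n+1)/N) ) + ψ(k). -/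
theorem hasDerivAt_log_Gamma {x : ℝ} (hx : 0 < x) :
    HasDerivAt (fun y => Real.log (Real.Gamma y)) (digamma x) x := by
  have hne : ∀ m : ℕ, x ≠ -m := fun m => by
    have : (0 : ℝ) ≤ m := m.cast_nonneg
    linarith
  exact ((Real.differentiableAt_Gamma hne).log (Real.Gamma_pos_of_pos hx).ne').hasDerivAt

theorem log_Gamma_add_one {x : ℝ} (hx : 0 < x) :
    Real.log (Real.Gamma (x + 1)) = Real.log x + Real.log (Real.Gamma x) := by
  rw [Real.Gamma_add_one hx.ne', Real.log_mul hx.ne' (Real.Gamma_pos_of_pos hx).ne']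

theorem digamma_add_one {x : ℝ} (hx : 0 < x) : digamma (x + 1) = digamma x + 1 / x := by
  have h1 : HasDerivAt (fun y => Real.log (Real.Gamma (y + 1))) (digamma (x + 1)) x :=
    (hasDerivAt_log_Gamma (by linarith : 0 < x + 1)).comp_add_const x 1
  have h2 : HasDerivAt (fun y => Real.log y + Real.log (Real.Gamma y)) (x⁻¹ + digamma x) x :=
    (Real.hasDerivAt_log hx.ne').add (hasDerivAt_log_Gamma hx)
  have h3 : (fun y => Real.log (Real.Gamma (y + 1))) =ᶠ[nhds x]
      fun y => Real.log y + Real.log (Real.Gamma y) := by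
    filter_upwards [lt_mem_nhds hx] with y hy using log_Gamma_add_one hy
  rw [h1.unique (h2.congr_of_eventuallyEq h3)]
  ring

theorem digamma_add_nat {x : ℝ} (hx : 0 < x) (M : ℕ) :
    digamma (x + M) = digamma x + ∑ m ∈ Finset.range M, 1 / (x + m) := by
  induction M with
  | zero => simp
  | succ M ih =>
    rw [Finset.sum_range_succ, Nat.cast_succ, ← add_assoc, digamma_add_one (by positivity), ih]
    ring

theorem digamma_le_log {x : ℝ} (hx : 0 < x) : digamma x ≤ Real.log x := by
  have h := Real.convexOn_log_Gamma.le_slope_of_hasDerivAt (x := x) (y := x + 1) hx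
    (Set.mem_Ioi.2 (by linarith)) (by linarith) (hasDerivAt_log_Gamma hx)
  simp only [slope_def_field, Function.comp_apply, log_Gamma_add_one hx] at h
  simpa using h

theorem log_le_digamma_add_one {x : ℝ} (hx : 0 < x) : Real.log x ≤ digamma (x + 1) := by
  have h := Real.convexOn_log_Gamma.slope_le_of_hasDerivAt (x := x) (y := x + 1) hx
    (Set.mem_Ioi.2 (by linarith)) (by linarith)
    (hasDerivAt_log_Gamma (by linarith : 0 < x + 1))
  simp only [slope_def_field, Function.comp_apply, log_Gamma_add_one hx] at h
  simpa using h

open Filter Topology in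
theorem tendsto_log_sub_sum_digamma {x : ℝ} (hx : 0 < x) :
    Tendsto (fun M : ℕ => Real.log M - ∑ m ∈ Finset.range M, 1 / (x + m)) atTop
      (𝓝 (digamma x)) := by
  have key : Tendsto (fun M : ℕ => digamma (x + M) - Real.log M) atTop (𝓝 0) := by
    have lim (y : ℝ) : Tendsto (fun M : ℕ => Real.log ((M : ℝ) + y) - Real.log M) atTop (𝓝 0) :=
      (Real.tendsto_log_comp_add_sub_log y).comp tendsto_natCast_atTop_atTop
    refine tendsto_of_tendsto_of_tendsto_of_le_of_le' (lim (x - 1)) (lim x) ?_ ?_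
    · filter_upwards [eventually_ge_atTop 1] with M hM
      have hM' : (1 : ℝ) ≤ M := by exact_mod_cast hM
      have h := log_le_digamma_add_one (x := M + (x - 1)) (by linarith)
      rw [show (M : ℝ) + (x - 1) + 1 = x + M by ring] at h
      linarith
    · filter_upwards with M
      have h := digamma_le_log (x := x + M) (by positivity)
      rw [add_comm (M : ℝ) x]
      linarith
  have := key.const_sub (digamma x)
  rw [sub_zero] at this
  refine this.congr fun M => ?_
  rw [digamma_add_nat hx]
  ring

theorem one_div_sq_le_telescope {s : ℝ} (hs : 0 < s) :
    1 / s ^ 2 ≤ (1 / s + 1 / (2 * s ^ 2) + 1 / (6 * s ^ 3)) -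
      (1 / (s + 1) + 1 / (2 * (s + 1) ^ 2) + 1 / (6 * (s + 1) ^ 3)) := by
  rw [← sub_nonneg]
  have : (1 / s + 1 / (2 * s ^ 2) + 1 / (6 * s ^ 3)) -
      (1 / (s + 1) + 1 / (2 * (s + 1) ^ 2) + 1 / (6 * (s + 1) ^ 3)) - 1 / s ^ 2 =
      1 / (6 * s ^ 3 * (s + 1) ^ 3) := by
    field_simp
    ring
  rw [this]
  positivity

theorem telescope_le_two_div_cube {s : ℝ} (hs : 0 < s) :
    (1 / s ^ 2 + 1 / s ^ 3 + 1 / (2 * s ^ 4) - 1 / (6 * s ^ 6)) -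
      (1 / (s + 1) ^ 2 + 1 / (s + 1) ^ 3 + 1 / (2 * (s + 1) ^ 4) - 1 / (6 * (s + 1) ^ 6)) ≤
      2 / s ^ 3 := by
  rw [← sub_nonneg]
  have : 2 / s ^ 3 - ((1 / s ^ 2 + 1 / s ^ 3 + 1 / (2 * s ^ 4) - 1 / (6 * s ^ 6)) -
      (1 / (s + 1) ^ 2 + 1 / (s + 1) ^ 3 + 1 / (2 * (s + 1) ^ 4) - 1 / (6 * (s + 1) ^ 6))) =
      (1 + 6 * s + 12 * s ^ 2 + 8 * s ^ 3) / (6 * s ^ 6 * (s + 1) ^ 6) := by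
    field_simp
    ring
  rw [this]
  positivity

theorem sum_two_mul_div_add_cube_le {x : ℝ} (hx : 1 ≤ x) (M : ℕ) :
    ∑ m ∈ Finset.range M, 2 * (m : ℝ) / (x + m) ^ 3 ≤ 1 / x := by
  set F : ℝ → ℝ := fun s => 2 * (1 / s + 1 / (2 * s ^ 2) + 1 / (6 * s ^ 3)) -
    x * (1 / s ^ 2 + 1 / s ^ 3 + 1 / (2 * s ^ 4) - 1 / (6 * s ^ 6)) with hF
  have hx0 : 0 < x := by linarith
  have hstep : ∀ m : ℕ, 2 * (m : ℝ) / (x + m) ^ 3 ≤ F (x + m) - F (x + m + 1) := by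
    intro m
    have hs : 0 < x + m := by positivity
    have h1 := one_div_sq_le_telescope hs
    have h2 := mul_le_mul_of_nonneg_left (telescope_le_two_div_cube hs) hx0.le
    have h3 : 2 * (m : ℝ) / (x + m) ^ 3 = 2 * (1 / (x + m) ^ 2) - x * (2 / (x + m) ^ 3) := by
      field_simp
      ring
    rw [h3]
    simp only [hF]
    linarith
  have hsum : ∑ m ∈ Finset.range M, 2 * (m : ℝ) / (x + m) ^ 3 ≤ F x - F (x + M) := by
    induction M with
    | zero => simp
    | succ M ih =>
      rw [Finset.sum_range_succ, Nat.cast_succ, ← add_assoc]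
      linarith [hstep M]
  have hend : 0 ≤ F (x + M) := by
    have hs : x ≤ x + M := by simp
    generalize x + (M : ℝ) = s at hs
    have hs0 : 0 < s := by linarith
    have hb : 0 ≤ 1 / s ^ 2 + 1 / s ^ 3 + 1 / (2 * s ^ 4) - 1 / (6 * s ^ 6) := by
      have h1 : 1 / (6 * s ^ 6) ≤ 1 / s ^ 2 := by
        apply one_div_le_one_div_of_le (by positivity)
        have : s ^ 2 ≤ s ^ 6 := pow_le_pow_right₀ (by linarith) (by norm_num)
        nlinarith [pow_pos hs0 6]
      have : 0 ≤ 1 / s ^ 3 + 1 / (2 * s ^ 4) := by positivity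
      linarith
    have h1 := mul_le_mul_of_nonneg_right hs hb
    have h2 : 2 * (1 / s + 1 / (2 * s ^ 2) + 1 / (6 * s ^ 3)) -
        s * (1 / s ^ 2 + 1 / s ^ 3 + 1 / (2 * s ^ 4) - 1 / (6 * s ^ 6)) =
        (5 * s ^ 4 + s ^ 2 * (s ^ 2 - 1) + 1) / (6 * s ^ 5) := by
      field_simp
      ring
    have h3 : 0 ≤ s ^ 2 - 1 := by nlinarith
    have h4 : 0 ≤ (5 * s ^ 4 + s ^ 2 * (s ^ 2 - 1) + 1) / (6 * s ^ 5) := by positivity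
    simp only [hF]
    linarith
  have hstart : F x ≤ 1 / x := by
    have h2 : 1 / x - F x = (x ^ 2 - 1) / (6 * x ^ 5) := by
      simp only [hF]
      field_simp
      ring
    have h3 : 0 ≤ x ^ 2 - 1 := by nlinarith
    have h4 : 0 ≤ (x ^ 2 - 1) / (6 * x ^ 5) := by positivity
    linarith
  linarith

theorem convexOn_mul_log_sub_log_add_sum (M : ℕ) :
    ConvexOn ℝ (Set.Ici 1) fun x : ℝ =>
      x * (Real.log x - (Real.log M - ∑ m ∈ Finset.range M, 1 / (x + m))) := by
  have hd1 : ∀ x : ℝ, 0 < x → HasDerivAt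
      (fun x : ℝ => x * (Real.log x - (Real.log M - ∑ m ∈ Finset.range M, 1 / (x + m))))
      (Real.log x + 1 - Real.log M + ∑ m ∈ Finset.range M, (m : ℝ) / (x + m) ^ 2) x := by
    intro x hx
    have hs : HasDerivAt (fun x : ℝ => ∑ m ∈ Finset.range M, x / (x + m))
        (∑ m ∈ Finset.range M, (m : ℝ) / (x + m) ^ 2) x := by
      refine HasDerivAt.fun_sum fun m _ => ?_
      have hne : x + m ≠ 0 := by positivity
      refine ((hasDerivAt_id' x).fun_div ((hasDerivAt_id' x).add_const (m : ℝ)) hne).congr_deriv ?_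
      ring
    have hfun : (fun x : ℝ => x * (Real.log x -
        (Real.log M - ∑ m ∈ Finset.range M, 1 / (x + m)))) = fun x : ℝ =>
        x * Real.log x - x * Real.log M + ∑ m ∈ Finset.range M, x / (x + m) := by
      ext y
      have : ∑ m ∈ Finset.range M, y / (y + m) = y * ∑ m ∈ Finset.range M, 1 / (y + m) := by
        rw [Finset.mul_sum]
        exact Finset.sum_congr rfl fun m _ => by ring
      rw [this]
      ring
    rw [hfun]
    refine (((Real.hasDerivAt_mul_log hx.ne').fun_sub
      ((hasDerivAt_id' x).mul_const (Real.log M))).fun_add hs).congr_deriv ?_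
    rw [one_mul]
  have hd2 : ∀ x : ℝ, 0 < x → HasDerivAt
      (fun x : ℝ => Real.log x + 1 - Real.log M + ∑ m ∈ Finset.range M, (m : ℝ) / (x + m) ^ 2)
      (1 / x - ∑ m ∈ Finset.range M, 2 * (m : ℝ) / (x + m) ^ 3) x := by
    intro x hx
    have hs : HasDerivAt (fun x : ℝ => ∑ m ∈ Finset.range M, (m : ℝ) / (x + m) ^ 2)
        (∑ m ∈ Finset.range M, -(2 * (m : ℝ) / (x + m) ^ 3)) x := by
      refine HasDerivAt.fun_sum fun m _ => ?_
      have hne : x + m ≠ 0 := by positivity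
      refine ((hasDerivAt_const x (m : ℝ)).fun_div
        (((hasDerivAt_id' x).add_const (m : ℝ)).fun_pow 2) (pow_ne_zero 2 hne)).congr_deriv ?_
      field_simp
      ring
    refine ((((Real.hasDerivAt_log hx.ne').add_const 1).sub_const
      (Real.log M)).fun_add hs).congr_deriv ?_
    rw [Finset.sum_neg_distrib]
    ring
  have hpos : ∀ x ∈ interior (Set.Ici (1 : ℝ)), 1 < x := by simp
  refine convexOn_of_hasDerivWithinAt2_nonneg (convex_Ici 1)
    (fun x hx => (hd1 x (zero_lt_one.trans_le hx)).continuousAt.continuousWithinAt)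
    (fun x hx => (hd1 x (zero_lt_one.trans (hpos x hx))).hasDerivWithinAt)
    (fun x hx => (hd2 x (zero_lt_one.trans (hpos x hx))).hasDerivWithinAt)
    fun x hx => sub_nonneg.2 (sum_two_mul_div_add_cube_le (hpos x hx).le M)

open Filter Topology in
theorem convexOn_mul_log_sub_digamma :
    ConvexOn ℝ (Set.Ici 1) fun x : ℝ => x * (Real.log x - digamma x) := by
  have lim : ∀ x : ℝ, 1 ≤ x → Tendsto (fun M : ℕ =>
      x * (Real.log x - (Real.log M - ∑ m ∈ Finset.range M, 1 / (x + m)))) atTop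
      (𝓝 (x * (Real.log x - digamma x))) := fun x hx =>
    ((tendsto_log_sub_sum_digamma (by linarith : 0 < x)).const_sub _).const_mul _
  refine ⟨convex_Ici 1, fun x hx y hy a b ha hb hab => ?_⟩
  exact le_of_tendsto_of_tendsto' (lim _ (convex_Ici 1 hx hy ha hb hab))
    (((lim x hx).const_smul a).add ((lim y hy).const_smul b))
    fun M => (convexOn_mul_log_sub_log_add_sum M).2 hx hy ha hb hab

theorem convexOn_mul_log_sub_digamma_mul {k : ℝ} (hk : 0 < k) :
    ConvexOn ℝ (Set.Ici (1 / k)) fun x : ℝ => x * (Real.log x - digamma (k * x)) := by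
  refine ⟨convex_Ici _, fun x hx y hy a b ha hb hab => ?_⟩
  have hmem : ∀ z ∈ Set.Ici (1 / k), k * z ∈ Set.Ici (1 : ℝ) := fun z hz => by
    have := (div_le_iff₀ hk).1 (Set.mem_Ici.1 hz)
    rw [Set.mem_Ici]
    linarith
  have hlog : ∀ z ∈ Set.Ici (1 / k), k * (z * (Real.log z - digamma (k * z))) =
      k * z * (Real.log (k * z) - digamma (k * z)) - k * z * Real.log k := fun z hz => by
    have hz0 : 0 < z := (one_div_pos.2 hk).trans_le hz
    rw [Real.log_mul hk.ne' hz0.ne']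
    ring
  have h := convexOn_mul_log_sub_digamma.2 (hmem x hx) (hmem y hy) ha hb hab
  have hxy := hlog _ (convex_Ici _ hx hy ha hb hab)
  have hx' := hlog x hx
  have hy' := hlog y hy
  simp only [smul_eq_mul] at h hxy ⊢
  rw [show a * (k * x) + b * (k * y) = k * (a * x + b * y) by ring] at h
  refine le_of_mul_le_mul_left ?_ hk
  rw [hxy]
  have hx2 := congrArg (a * ·) hx'
  have hy2 := congrArg (b * ·) hy'
  linarith

theorem ConvexOn.sum_le_of_sum_eq {n : ℕ} {f : ℝ → ℝ} {a b : ℝ}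
    (hf : ConvexOn ℝ (Set.Icc a b) f) (hn : 1 ≤ n) (p : Fin n → ℝ)
    (hp : ∀ i, p i ∈ Set.Icc a b) (hsum : ∑ i, p i = (n - 1) * a + b) :
    ∑ i, f (p i) ≤ (n - 1) * f a + f b := by
  have hab : a ≤ b := (hp ⟨0, hn⟩).1.trans (hp ⟨0, hn⟩).2
  rcases hab.eq_or_lt with rfl | hlt
  · have : ∀ i, p i = a := fun i => le_antisymm (hp i).2 (hp i).1
    simp only [this, Finset.sum_const, Finset.card_univ, Fintype.card_fin, nsmul_eq_mul]
    linarith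
  have hba : 0 < b - a := sub_pos.2 hlt
  have hchord : ∀ i, f (p i) ≤ f a + (p i - a) * ((f b - f a) / (b - a)) := fun i => by
    have h := hf.2 (Set.left_mem_Icc.2 hab) (Set.right_mem_Icc.2 hab)
      (div_nonneg (sub_nonneg.2 (hp i).2) hba.le) (div_nonneg (sub_nonneg.2 (hp i).1) hba.le)
      (by field_simp; ring)
    simp only [smul_eq_mul] at h
    have h1 : (b - p i) / (b - a) * a + (p i - a) / (b - a) * b = p i := by
      field_simp
      ring
    have h2 : (b - p i) / (b - a) * f a + (p i - a) / (b - a) * f b =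
        f a + (p i - a) * ((f b - f a) / (b - a)) := by
      field_simp
      ring
    rwa [h1, h2] at h
  calc ∑ i, f (p i) ≤ ∑ i, (f a + (p i - a) * ((f b - f a) / (b - a))) :=
        Finset.sum_le_sum fun i _ => hchord i
    _ = (n - 1) * f a + f b := by
        rw [Finset.sum_add_distrib, ← Finset.sum_mul, Finset.sum_sub_distrib, hsum]
        simp only [Finset.sum_const, Finset.card_univ, Fintype.card_fin, nsmul_eq_mul]
        field_simp
        ring

theorem stmt_7 (n N : ℕ) (hn : 2 ≤ n) (hnN : n ≤ N) (k : ℝ)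
    (hk : 3 * (N:ℝ) / 2 ≤ k)
    (p : Fin n → ℝ) (hsum : ∑ i, p i = 1)
    (hp : ∀ i, p i ∈ Set.Icc (1/(N:ℝ)) (((N:ℝ) - n + 1)/N)) :
    ∑ i, p i * (Real.log (p i) + digamma k - digamma (k * p i)) ≤
      ((n:ℝ)-1)/N * (Real.log (1/(N:ℝ)) - digamma (k/(N:ℝ))) +
        ((N:ℝ)-n+1)/N * (Real.log (((N:ℝ)-n+1)/N) - digamma (k*((N:ℝ)-n+1)/N)) +
        digamma k := by
  have hN : (0 : ℝ) < N := by exact_mod_cast (by omega : 0 < N)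
  have hk0 : 0 < k := by linarith
  have hsub : Set.Icc (1 / (N : ℝ)) (((N : ℝ) - n + 1) / N) ⊆ Set.Ici (1 / k) := fun x hx =>
    (one_div_le_one_div_of_le hN (by linarith)).trans hx.1
  have h := ((convexOn_mul_log_sub_digamma_mul hk0).subset hsub (convex_Icc _ _)).sum_le_of_sum_eq
    (by omega : 1 ≤ n) p hp (by rw [hsum]; field_simp; ring)
  have hsplit : ∑ i, p i * (Real.log (p i) + digamma k - digamma (k * p i)) =
      ∑ i, p i * (Real.log (p i) - digamma (k * p i)) + digamma k := by
    conv_rhs => rw [← one_mul (digamma k), ← hsum, Finset.sum_mul, ← Finset.sum_add_distrib]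
    exact Finset.sum_congr rfl fun i _ => by ring
  rw [hsplit]
  rw [mul_one_div, ← mul_div_assoc] at h
  linarith [show ((n : ℝ) - 1) * (1 / N * (Real.log (1 / N) - digamma (k / N))) =
    (n - 1) / N * (Real.log (1 / N) - digamma (k / N)) by ring]
end
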